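/- For every integer m ≥ 1 and every integer k ≥ 1, the integer S(m,k) := ∑_{q ∣ k} (−1)^{k + k/q} μ(q) m^{k/q} is nonnegative. (Equivalently, c_{m,k} = S(m,k)/k ≥ 0, as it must be since c_{m,k} is the dimension of a cohomology vector space.) -/

import Mathlib

open scoped BigOperators

/-- `S m k = ∑_{q ∣ k} (−1)^(k + k/q) μ(q) m^(k/q)`. -/
def S (m k : ℕ) : ℤ :=
  ∑ q ∈ Nat.divisors k,
    (-1 : ℤ) ^ (k + k / q) * (ArithmeticFunction.moebius q) * (m : ℤ) ^ (k / q)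

/-- The divisor sum of the Möbius function is the indicator of `1`. -/
lemma sum_moebius_divisors (n : ℕ) :
    ∑ q ∈ n.divisors, ArithmeticFunction.moebius q = if n = 1 then 1 else 0 := by
  rw [← ArithmeticFunction.coe_zeta_mul_apply, ArithmeticFunction.coe_zeta_mul_moebius,
    ArithmeticFunction.one_apply]

lemma S_one_of_odd {k : ℕ} (hk : Odd k) : S 1 k = if k = 1 then 1 else 0 := by
  rw [← sum_moebius_divisors]
  refine Finset.sum_congr rfl fun q hq => ?_
  have h : Odd (k / q) := hk.of_dvd_nat (Nat.div_dvd_of_dvd (Nat.dvd_of_mem_divisors hq))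
  simp [(hk.add_odd h).neg_one_pow]

lemma S_one_two_mul {n : ℕ} (hn : n ≠ 0) : S 1 (2 * n) = if n = 1 then 2 else 0 := by
  have hdiv : n.divisors = (2 * n).divisors.filter (· ∣ n) := by
    ext q
    simp only [Nat.mem_divisors, Finset.mem_filter]
    exact ⟨fun h => ⟨⟨h.1.mul_left 2, by lia⟩, h.1⟩, fun h => ⟨h.2, hn⟩⟩
  have key : S 1 (2 * n) = 2 * ∑ q ∈ n.divisors, ArithmeticFunction.moebius q -
      ∑ q ∈ (2 * n).divisors, ArithmeticFunction.moebius q := by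
    rw [hdiv, Finset.sum_filter, Finset.mul_sum, ← Finset.sum_sub_distrib]
    refine Finset.sum_congr rfl fun q hq => ?_
    obtain ⟨d, hd⟩ := Nat.dvd_of_mem_divisors hq
    have hq0 : 0 < q := Nat.pos_of_mem_divisors hq
    have hquot : 2 * n / q = d := by rw [hd, Nat.mul_div_cancel_left _ hq0]
    have hiff : q ∣ n ↔ Even d := by
      rw [even_iff_two_dvd]
      constructor
      · rintro ⟨c, rfl⟩
        exact ⟨c, Nat.eq_of_mul_eq_mul_left hq0 (by linarith)⟩
      · rintro ⟨c, rfl⟩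
        exact ⟨c, by linarith⟩
    rw [hquot, pow_add, (even_two_mul n).neg_one_pow]
    by_cases h : Even d
    · simp only [h.neg_one_pow, hiff, h, if_true, Nat.cast_one, one_pow]
      ring
    · simp [(Nat.not_even_iff_odd.mp h).neg_one_pow, hiff, h]
  rw [key, sum_moebius_divisors, sum_moebius_divisors, if_neg (by lia : ¬ 2 * n = 1)]
  split_ifs <;> rfl

lemma S_pos_of_two_le {m k : ℕ} (hm : 2 ≤ m) (hk : k ≠ 0) : 0 < S m k := by
  have hS : S m k = (m : ℤ) ^ k + ∑ d ∈ k.properDivisors,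
      (-1 : ℤ) ^ (k + d) * ArithmeticFunction.moebius (k / d) * (m : ℤ) ^ d := by
    have h := Nat.sum_div_divisors k fun d =>
      (-1 : ℤ) ^ (k + d) * ArithmeticFunction.moebius (k / d) * (m : ℤ) ^ d
    nth_rewrite 2 [← Nat.cons_self_properDivisors hk] at h
    rw [Finset.sum_cons, Nat.div_self (Nat.pos_of_ne_zero hk), (Even.add_self k).neg_one_pow,
      ArithmeticFunction.moebius_apply_one, one_mul, one_mul] at h
    rw [S, ← h]
    refine Finset.sum_congr rfl fun q hq => ?_
    rw [Nat.div_div_self (Nat.dvd_of_mem_divisors hq) hk]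
  have hbound : |∑ d ∈ k.properDivisors,
      (-1 : ℤ) ^ (k + d) * ArithmeticFunction.moebius (k / d) * (m : ℤ) ^ d| ≤
      ∑ d ∈ k.properDivisors, (m : ℤ) ^ d := by
    refine (Finset.abs_sum_le_sum_abs _ _).trans (Finset.sum_le_sum fun d _ => ?_)
    rw [abs_mul, abs_mul, abs_neg_one_pow, one_mul, abs_pow, Nat.abs_cast]
    exact mul_le_of_le_one_left (by positivity) ArithmeticFunction.abs_moebius_le_one
  have hgeom : ∑ d ∈ k.properDivisors, (m : ℤ) ^ d < (m : ℤ) ^ k := by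
    exact_mod_cast Nat.geomSum_lt hm fun d hd => (Nat.mem_properDivisors.mp hd).2
  rw [hS]
  linarith [neg_le_of_abs_le hbound]

theorem S_nonneg (m k : ℕ) (hm : 1 ≤ m) (hk : 1 ≤ k) : 0 ≤ S m k := by
  obtain rfl | hm := hm.eq_or_lt
  · obtain h | h := k.even_or_odd
    · obtain ⟨n, rfl⟩ := h.two_dvd
      rw [S_one_two_mul (by lia)]
      split_ifs <;> norm_num
    · rw [S_one_of_odd h]
      split_ifs <;> norm_num
  · exact (S_pos_of_two_le hm (by lia)).le
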